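/- arXiv:2208.12183 — 5 statements merged into one kernel-verified Lean document; each statement's English description precedes it below -/
import Mathlib

section
/- Let A be a real symmetric positive definite N×N matrix, b ∈ ℝ^N, and g(x) = (1/2)xᵀAx + xᵀb, so ∇g(x) = Ax + b. Let {x^(l), p^(l)} be generated by FR gradient descent with fixed step size α > 0: starting from x^(0) ∈ ℝ^N with p^(1) = −∇g(x^(0)) and x^(1) = x^(0) + α p^(1), and for l ≥ 1, β^(l+1) = ‖∇g(x^(l))‖₂²/‖∇g(x^(l−1))‖₂², p^(l+1) = −∇g(x^(l)) + β^(l+1) p^(l), x^(l+1) = x^(l) + α p^(l+1). Set r^(l) = ∇g(x^(l)), ρ = max_{0 ≤ j ≤ i ≤ l−1} ‖r^(i)‖₂²/‖r^(j)‖₂², z^(l) = r^(l)/‖r^(l)‖₂, and Z^(l) = [z^(0), …, z^(l−1)] ∈ ℝ^{N×l}. If z^(0), …, z^(l) are linearly independent, then, with κ(Z^(l+1)) := ‖Z^(l+1)‖₂ · ‖((Z^(l+1))ᵀ Z^(l+1))^{−1} (Z^(l+1))ᵀ‖₂ and κ(A) := λ_max(A)/λ_min(A), the residual satisfies ‖r^(l)‖₂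 ≤ 2 (1 + K_l) ((√κ(A) − 1)/(√κ(A) + 1))^l ‖r^(0)‖₂ for some constant K_l with 0 ≤ K_l ≤ l α (1 + lρ/2) ‖A‖₂ κ(Z^(l+1)). -/
open Matrix

/-- The Euclidean (ℓ²) norm of a vector in `ℝ^N`. -/
noncomputable def euclNorm {N : ℕ} (x : Fin N → ℝ) : ℝ := Real.sqrt (∑ i, x i ^ 2)

/-- The spectral norm (operator 2-norm) of a real matrix. -/
noncomputable def specNorm {m n : ℕ} (A : Matrix (Fin m) (Fin n) ℝ) : ℝ :=
  ‖(Matrix.toEuclideanLin A).toContinuousLinearMap‖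

open Polynomial in
/-- Scaled Chebyshev polynomials are small on `[a, b]` while taking the value `1` at `0`. -/
lemma exists_polynomial_abs_eval_le {a b : ℝ} (ha : 0 < a) (hab : a ≤ b) {l : ℕ} (hl : 1 ≤ l) :
    ∃ p : ℝ[X], p.natDegree ≤ l ∧ p.coeff 0 = 1 ∧ ∀ t, a ≤ t → t ≤ b →
      |p.eval t| ≤ 2 * ((√(b / a) - 1) / (√(b / a) + 1)) ^ l := by
  rcases hab.eq_or_lt with rfl | hlt
  · refine ⟨1 - C a⁻¹ * X, ?_, by simp, fun t h1 h2 => ?_⟩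
    · exact le_trans (by compute_degree) hl
    · obtain rfl := le_antisymm h1 h2
      simp [ha.ne', show l ≠ 0 by omega]
  set s := √(b / a) with hs
  have hs1 : 1 < s := by
    rw [hs, Real.lt_sqrt zero_le_one]
    simpa using (one_lt_div ha).2 hlt
  have hs2 : s ^ 2 = b / a := Real.sq_sqrt (div_pos (ha.trans hlt) ha).le
  have hb : b = s ^ 2 * a := by rw [hs2]; field_simp
  set w := (s + 1) / (s - 1) with hw
  have hs1' : 0 < s - 1 := by linarith
  have hw0 : 0 < w := by positivity
  have hba : 0 < b - a := by linarith
  have hc : (b + a) / (b - a) = (w + w⁻¹) / 2 := by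
    have h1 : s ^ 2 * a - a ≠ 0 := by rw [← hb]; exact hba.ne'
    have h2 : s ^ 2 - 1 ≠ 0 := by nlinarith
    have h3 : s - 1 ≠ 0 := hs1'.ne'
    have h4 : s + 1 ≠ 0 := by linarith
    have h5 : s ^ 2 * a - a = (s - 1) * (s + 1) * a := by ring
    rw [hw, hb, h5]
    field_simp
    ring
  have hT : (Chebyshev.T ℝ l).eval ((b + a) / (b - a)) = (w ^ l + (w ^ l)⁻¹) / 2 := by
    rw [hc, ← Real.cosh_log hw0, Chebyshev.T_real_cosh, ← Real.cosh_log (pow_pos hw0 l),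
      Real.log_pow]
    simp
  have hwl : 0 < w ^ l := pow_pos hw0 l
  set τ := (Chebyshev.T ℝ l).eval ((b + a) / (b - a)) with hτ
  have hτ0 : w ^ l / 2 ≤ τ := by
    rw [hT]
    have := inv_pos.2 hwl
    linarith
  have hτpos : 0 < τ := lt_of_lt_of_le (by positivity) hτ0
  refine ⟨C τ⁻¹ * (Chebyshev.T ℝ l).comp (C ((b + a) / (b - a)) - C (2 / (b - a)) * X),
    ?_, ?_, fun t h1 h2 => ?_⟩
  · refine (natDegree_C_mul_le _ _).trans ((natDegree_comp_le).trans ?_)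
    rw [Chebyshev.natDegree_T]
    calc _ ≤ l * 1 := Nat.mul_le_mul (by simp) (by compute_degree)
      _ = l := mul_one l
  · rw [coeff_zero_eq_eval_zero]
    simp only [eval_mul, eval_C, eval_comp, eval_sub, eval_X, mul_zero, sub_zero]
    rw [← hτ]
    exact inv_mul_cancel₀ hτpos.ne'
  · simp only [eval_mul, eval_C, eval_comp, eval_sub, eval_X]
    have hle : |(b + a) / (b - a) - 2 / (b - a) * t| ≤ 1 := by
      have : (b + a) / (b - a) - 2 / (b - a) * t = (b + a - 2 * t) / (b - a) := by ring
      rw [this, abs_le, le_div_iff₀ hba, div_le_iff₀ hba]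
      constructor <;> linarith
    rw [abs_mul, abs_of_pos (inv_pos.2 hτpos)]
    have h3 := Chebyshev.abs_eval_T_real_le_one l hle
    calc _ ≤ τ⁻¹ * 1 := by gcongr
      _ ≤ (w ^ l / 2)⁻¹ := by rw [mul_one]; gcongr
      _ = 2 * (w⁻¹) ^ l := by rw [inv_div, div_eq_mul_inv, inv_pow]
      _ = _ := by rw [hw, inv_div]

open Polynomial in
/-- A polynomial in a diagonalizable operator is bounded by the polynomial on the eigenvalues. -/
lemma OrthonormalBasis.norm_aeval_apply_le {ι E : Type*} [Fintype ι] [NormedAddCommGroup E]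
    [InnerProductSpace ℝ E] (e : OrthonormalBasis ι ℝ E) (T : Module.End ℝ E) (μ : ι → ℝ)
    (he : ∀ i, T (e i) = μ i • e i) (p : ℝ[X]) {M : ℝ} (hM : 0 ≤ M)
    (hp : ∀ i, |p.eval (μ i)| ≤ M) (v : E) : ‖aeval T p v‖ ≤ M * ‖v‖ := by
  have hpe : ∀ i, aeval T p (e i) = p.eval (μ i) • e i := fun i =>
    Module.End.aeval_apply_of_hasEigenvector
      ⟨Module.End.mem_eigenspace_iff.2 (he i), e.orthonormal.ne_zero i⟩
  have hv : aeval T p v = ∑ i, (p.eval (μ i) * inner ℝ (e i) v) • e i := by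
    conv_lhs => rw [← e.sum_repr' v]
    simp only [map_sum, map_smul, hpe, smul_smul]
    exact Finset.sum_congr rfl fun i _ => by rw [mul_comm]
  have hi : ∀ i, inner ℝ (e i) (aeval T p v) = p.eval (μ i) * inner ℝ (e i) v := fun i => by
    rw [hv]
    exact e.orthonormal.inner_right_fintype _ i
  refine le_of_sq_le_sq ?_ (by positivity)
  rw [mul_pow, ← e.sum_sq_norm_inner_right, ← e.sum_sq_norm_inner_right v, Finset.mul_sum]
  refine Finset.sum_le_sum fun i _ => ?_
  rw [hi, norm_mul, mul_pow]
  gcongr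
  exact hp i

lemma sum_range_smul_sub {E : Type*} [AddCommGroup E] [Module ℝ E] (a : ℕ → ℝ) (R : ℕ → E)
    (n : ℕ) :
    ∑ m ∈ Finset.range n, (∑ k ∈ Finset.range (m + 1), a k) • (R m - R (m + 1)) =
      ∑ k ∈ Finset.range n, a k • R k - (∑ k ∈ Finset.range n, a k) • R n := by
  induction n with
  | zero => simp
  | succ n ih =>
    rw [Finset.sum_range_succ, ih, Finset.sum_range_succ (fun k => a k • R k),
      Finset.sum_range_succ a]
    module

open Polynomial in
/-- Krylov vectors generated by `R 0` lie in the span of the `R k`, and differ from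
`p(0) R 0` by a combination of consecutive differences. -/
lemma aeval_apply_mem_span {E : Type*} [AddCommGroup E] [Module ℝ E] (T : Module.End ℝ E)
    (R : ℕ → E) (l : ℕ)
    (hT : ∀ k < l, T (R k) ∈ Submodule.span ℝ ((fun j => R j - R (j + 1)) '' Set.Iio (k + 1)))
    (n : ℕ) (hn : n ≤ l) (p : ℝ[X]) (hp : p.natDegree ≤ n) :
    aeval T p (R 0) - p.coeff 0 • R 0 ∈
        Submodule.span ℝ ((fun j => R j - R (j + 1)) '' Set.Iio n) ∧
      aeval T p (R 0) ∈ Submodule.span ℝ (R '' Set.Iio (n + 1)) := by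
  have key : ∀ n, Submodule.span ℝ ((fun j => R j - R (j + 1)) '' Set.Iio n) ≤
      Submodule.span ℝ (R '' Set.Iio (n + 1)) := by
    intro n
    rw [Submodule.span_le]
    rintro _ ⟨j, hj, rfl⟩
    have hj : j < n := hj
    exact Submodule.sub_mem _
      (Submodule.subset_span ⟨j, by simp only [Set.mem_Iio]; omega, rfl⟩)
      (Submodule.subset_span ⟨j + 1, by simp only [Set.mem_Iio]; omega, rfl⟩)
  have step : ∀ n (p : ℝ[X]), aeval T p (R 0) - p.coeff 0 • R 0 ∈
        Submodule.span ℝ ((fun j => R j - R (j + 1)) '' Set.Iio n) →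
      aeval T p (R 0) ∈ Submodule.span ℝ (R '' Set.Iio (n + 1)) := by
    intro n p h
    have h0 : R 0 ∈ Submodule.span ℝ (R '' Set.Iio (n + 1)) :=
      Submodule.subset_span ⟨0, by simp, rfl⟩
    simpa using Submodule.add_mem _ (key n h) (Submodule.smul_mem _ (p.coeff 0) h0)
  suffices h : aeval T p (R 0) - p.coeff 0 • R 0 ∈
      Submodule.span ℝ ((fun j => R j - R (j + 1)) '' Set.Iio n) from ⟨h, step n p h⟩
  induction n generalizing p with
  | zero =>
    rw [eq_C_of_natDegree_le_zero hp]
    simp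
  | succ n ih =>
    have hd : p.divX.natDegree ≤ n := by
      rw [natDegree_divX_eq_natDegree_tsub_one]; omega
    have h1 := step n _ (ih (by omega) p.divX hd)
    have h2 : aeval T p (R 0) - p.coeff 0 • R 0 = T (aeval T p.divX (R 0)) := by
      conv_lhs => rw [← divX_mul_X_add p]
      rw [mul_comm, map_add, map_mul, aeval_X, aeval_C, LinearMap.add_apply,
        Module.End.mul_apply, Module.algebraMap_end_apply]
      simp
    rw [h2]
    have h3 : Submodule.span ℝ (R '' Set.Iio (n + 1)) ≤
        (Submodule.span ℝ ((fun j => R j - R (j + 1)) '' Set.Iio (n + 1))).comap T := by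
      rw [Submodule.span_le]
      rintro _ ⟨k, hk, rfl⟩
      have hk : k < n + 1 := hk
      refine Submodule.span_mono (Set.image_mono (Set.Iio_subset_Iio ?_)) (hT k (by omega))
      omega
    exact h3 h1

lemma sum_fin_ite_lt {M : Type*} [AddCommMonoid M] {m n : ℕ} (hmn : m ≤ n) (f : ℕ → M) :
    ∑ k : Fin n, (if (k : ℕ) < m then f k else 0) = ∑ k ∈ Finset.range m, f k := by
  rw [← Finset.sum_range (fun k => if k < m then f k else 0), ← Finset.sum_filter]
  congr 1
  ext k
  simp only [Finset.mem_filter, Finset.mem_range]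
  omega

open Polynomial in
/-- Residuals of Fletcher–Reeves gradient descent are comparable to any Krylov vector. -/
lemma norm_residual_le {E : Type*} [NormedAddCommGroup E] [InnerProductSpace ℝ E] {l : ℕ}
    (T : E →L[ℝ] E) (W : EuclideanSpace ℝ (Fin (l + 1)) →L[ℝ] E)
    (G : E →L[ℝ] EuclideanSpace ℝ (Fin (l + 1))) (hGW : ∀ c, G (W c) = c)
    (R : ℕ → E) (hR : ∀ k ≤ l, R k ≠ 0)
    (hW : ∀ c, W c = ∑ k, c k • (‖R k‖⁻¹ • R k))
    {α ρ : ℝ} (hα : 0 < α)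
    (hρ : ∀ i j, j ≤ i → i < l → ‖R i‖ ^ 2 / ‖R j‖ ^ 2 ≤ ρ)
    (hrec : ∀ k < l, R k - R (k + 1) =
      (α * ‖R k‖ ^ 2) • T (∑ j ∈ Finset.range (k + 1), (‖R j‖ ^ 2)⁻¹ • R j))
    (p : ℝ[X]) (hp : p.natDegree ≤ l) (hp0 : p.coeff 0 = 1) :
    ‖R l‖ ≤ (1 + l * α * (1 + l * ρ / 2) * ‖T‖ * (‖W‖ * ‖G‖)) *
      ‖aeval (T : Module.End ℝ E) p (R 0)‖ := by
  set S : ℕ → E := fun k => ∑ j ∈ Finset.range k, (‖R j‖ ^ 2)⁻¹ • R j with hS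
  have hn : ∀ k ≤ l, 0 < ‖R k‖ := fun k hk => norm_pos_iff.2 (hR k hk)
  -- each `T (R k)` is a combination of differences of consecutive residuals
  have hTS : ∀ k < l, T (S (k + 1)) = (α * ‖R k‖ ^ 2)⁻¹ • (R k - R (k + 1)) := by
    intro k hk
    have := hn k hk.le
    rw [hrec k hk, smul_smul, inv_mul_cancel₀ (by positivity), one_smul]
  have hTSmem : ∀ k ≤ l, T (S k) ∈
      Submodule.span ℝ ((fun j => R j - R (j + 1)) '' Set.Iio k) := by
    intro k hk
    rcases k with _ | k
    · simp [hS]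
    · rw [hTS k hk]
      exact Submodule.smul_mem _ _ (Submodule.subset_span ⟨k, by simp, rfl⟩)
  have hT : ∀ k < l, (T : Module.End ℝ E) (R k) ∈
      Submodule.span ℝ ((fun j => R j - R (j + 1)) '' Set.Iio (k + 1)) := by
    intro k hk
    have := hn k hk.le
    have h1 : R k = ‖R k‖ ^ 2 • (S (k + 1) - S k) := by
      simp only [hS]
      rw [Finset.sum_range_succ, add_sub_cancel_left, smul_smul, mul_inv_cancel₀ (by positivity),
        one_smul]
    rw [h1, map_smul, map_sub]
    refine Submodule.smul_mem _ _ (Submodule.sub_mem _ (hTSmem _ hk) ?_)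
    exact Submodule.span_mono (Set.image_mono (Set.Iio_subset_Iio (by omega))) (hTSmem _ hk.le)
  obtain ⟨hv1, hv2⟩ := aeval_apply_mem_span (T : Module.End ℝ E) R l hT l le_rfl p hp
  set v := aeval (T : Module.End ℝ E) p (R 0) with hv
  -- coordinates of the residuals
  have hWs : ∀ k (hk : k < l + 1), W (EuclideanSpace.single ⟨k, hk⟩ ‖R k‖) = R k := by
    intro k hk
    have := (hn k (by omega)).ne'
    rw [hW, Finset.sum_eq_single ⟨k, hk⟩]
    · simp [smul_smul, this]
    · intro j _ hj; simp [hj]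
    · simp
  have hGR : ∀ k (hk : k < l + 1), G (R k) = EuclideanSpace.single ⟨k, hk⟩ ‖R k‖ := by
    intro k hk
    conv_lhs => rw [← hWs k hk]
    rw [hGW]
  set c := G v with hc
  have hWc : W c = v := by
    have : Submodule.span ℝ (R '' Set.Iio (l + 1)) ≤ LinearMap.range (W : EuclideanSpace ℝ (Fin (l + 1)) →ₗ[ℝ] E) := by
      rw [Submodule.span_le]
      rintro _ ⟨k, hk, rfl⟩
      exact ⟨_, hWs k hk⟩
    obtain ⟨d, hd⟩ := this hv2
    have hd : W d = v := hd
    rw [hc, ← hd, hGW]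
  -- the functional taking the value `1` on every residual
  set φ : E →ₗ[ℝ] ℝ :=
    ∑ k : Fin (l + 1), ‖R k‖⁻¹ • ((EuclideanSpace.proj k : _ →L[ℝ] ℝ) ∘L G : E →ₗ[ℝ] ℝ) with hφ
  have hφa : ∀ u, φ u = ∑ k : Fin (l + 1), ‖R k‖⁻¹ * G u k := by
    intro u; simp [hφ]
  have hφR : ∀ k ≤ l, φ (R k) = 1 := by
    intro k hk
    have := (hn k hk).ne'
    rw [hφa, hGR k (by omega), Finset.sum_eq_single ⟨k, by omega⟩]
    · simp [this]
    · intro j _ hj; simp [hj]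
    · simp
  have hφv : φ v = 1 := by
    have : Submodule.span ℝ ((fun j => R j - R (j + 1)) '' Set.Iio l) ≤ LinearMap.ker φ := by
      rw [Submodule.span_le]
      rintro _ ⟨k, hk, rfl⟩
      have hk : k < l := hk
      simp [hφR k hk.le, hφR (k + 1) hk]
    have := this hv1
    rw [LinearMap.mem_ker, map_sub, hp0, one_smul, hφR 0 (by omega)] at this
    linarith
  set a : ℕ → ℝ := fun k => if hk : k < l + 1 then ‖R k‖⁻¹ * c ⟨k, hk⟩ else 0 with ha
  have hasum : ∑ k ∈ Finset.range (l + 1), a k = 1 := by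
    rw [← hφv, hφa, Finset.sum_range]
    exact Finset.sum_congr rfl fun k _ => by rw [ha]; simp only [dif_pos k.2, Fin.eta]; rw [← hc]
  have hav : ∑ k ∈ Finset.range (l + 1), a k • R k = v := by
    rw [← hWc, hW, Finset.sum_range]
    exact Finset.sum_congr rfl fun k _ => by
      rw [ha]; simp only [dif_pos k.2, Fin.eta]; rw [smul_smul, mul_comm]
  set s : ℕ → ℝ := fun m => ∑ k ∈ Finset.range (m + 1), a k with hs
  set u : E := ∑ m ∈ Finset.range l, (α * ‖R m‖ ^ 2 * s m) • S (m + 1) with hu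
  have hTu : R l = v - T u := by
    have h1 : T u = ∑ m ∈ Finset.range l, s m • (R m - R (m + 1)) := by
      rw [hu, map_sum]
      refine Finset.sum_congr rfl fun m hm => ?_
      have hm := Finset.mem_range.1 hm
      have := hn m hm.le
      rw [map_smul, hTS m hm, smul_smul]
      congr 1
      field_simp
    rw [h1, sum_range_smul_sub, ← hav, Finset.sum_range_succ]
    rw [Finset.sum_range_succ] at hasum
    have : a l = 1 - ∑ k ∈ Finset.range l, a k := by linarith
    rw [this]
    module
  -- size of the correction
  set V : ℕ → EuclideanSpace ℝ (Fin (l + 1)) := fun m =>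
    WithLp.toLp 2 fun k => if (k : ℕ) < m then ‖R k‖⁻¹ else 0 with hV
  have hSV : ∀ m ≤ l + 1, S m = W (V m) := by
    intro m hm
    rw [hW, hS]
    simp only [hV, ite_smul, zero_smul]
    rw [sum_fin_ite_lt hm (fun k => ‖R k‖⁻¹ • ‖R k‖⁻¹ • R k)]
    exact Finset.sum_congr rfl fun k _ => by rw [smul_smul, ← mul_inv, ← sq]
  have hVnorm : ∀ m ≤ l + 1, ‖V m‖ ^ 2 = ∑ k ∈ Finset.range m, (‖R k‖ ^ 2)⁻¹ := by
    intro m hm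
    rw [EuclideanSpace.real_norm_sq_eq, ← sum_fin_ite_lt hm (fun k => (‖R k‖ ^ 2)⁻¹)]
    exact Finset.sum_congr rfl fun k _ => by simp only [hV]; split_ifs <;> simp
  have hsV : ∀ m < l, |s m| ≤ ‖V (m + 1)‖ * ‖c‖ := by
    intro m hm
    have : s m = inner ℝ (V (m + 1)) c := by
      rw [PiLp.inner_apply, hs]
      simp only
      rw [← sum_fin_ite_lt (show m + 1 ≤ l + 1 by omega) a]
      refine Finset.sum_congr rfl fun k _ => ?_
      simp only [hV, ha, dif_pos k.2, Fin.eta]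
      split_ifs <;> simp [mul_comm]
    rw [this]
    exact abs_real_inner_le_norm _ _
  have hVρ : ∀ m < l, ‖R m‖ ^ 2 * ‖V (m + 1)‖ ^ 2 ≤ 1 + m * ρ := by
    intro m hm
    have := hn m hm.le
    rw [hVnorm _ (by omega), Finset.sum_range_succ, mul_add, mul_inv_cancel₀ (by positivity),
      add_comm, Finset.mul_sum]
    gcongr
    calc _ ≤ ∑ _k ∈ Finset.range m, ρ := Finset.sum_le_sum fun k hk => by
          rw [← div_eq_mul_inv]
          exact hρ m k (Finset.mem_range.1 hk).le hm
      _ = m * ρ := by simp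
  have hu_le : ‖u‖ ≤ α * (l * (1 + l * ρ / 2)) * ‖W‖ * ‖c‖ := by
    have hsum : ∑ m ∈ Finset.range l, (1 + m * ρ) = l + ρ * (l * (l - 1) / 2) := by
      clear * -
      induction l with
      | zero => simp
      | succ l ih => rw [Finset.sum_range_succ, ih]; push_cast; ring
    have hlρ : 0 ≤ l * ρ := by
      rcases Nat.eq_zero_or_pos l with h | h
      · simp [h]
      · exact mul_nonneg (by positivity) (le_trans (by positivity) (hρ 0 0 le_rfl h))
    calc ‖u‖ ≤ ∑ m ∈ Finset.range l, (1 + m * ρ) * (α * ‖W‖ * ‖c‖) := by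
          refine (norm_sum_le _ _).trans (Finset.sum_le_sum fun m hm => ?_)
          have hm := Finset.mem_range.1 hm
          have hSm : ‖S (m + 1)‖ ≤ ‖W‖ * ‖V (m + 1)‖ := by
            rw [hSV _ (by omega)]; exact W.le_opNorm _
          calc _ = α * ‖R m‖ ^ 2 * |s m| * ‖S (m + 1)‖ := by
                rw [norm_smul, norm_mul, norm_mul, Real.norm_eq_abs, Real.norm_eq_abs,
                  abs_of_pos hα, Real.norm_eq_abs, abs_of_nonneg (sq_nonneg _)]
            _ ≤ α * ‖R m‖ ^ 2 * (‖V (m + 1)‖ * ‖c‖) * (‖W‖ * ‖V (m + 1)‖) := by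
                gcongr
                exact hsV m hm
            _ = ‖R m‖ ^ 2 * ‖V (m + 1)‖ ^ 2 * (α * ‖W‖ * ‖c‖) := by ring
            _ ≤ _ := by gcongr; exact hVρ m hm
      _ = (l + ρ * (l * (l - 1) / 2)) * (α * ‖W‖ * ‖c‖) := by rw [← Finset.sum_mul, hsum]
      _ ≤ (l * (1 + l * ρ / 2)) * (α * ‖W‖ * ‖c‖) := by
          gcongr
          nlinarith
      _ = _ := by ring
  have hl0 : 0 ≤ α * (l * (1 + l * ρ / 2)) * ‖W‖ := by
    rcases Nat.eq_zero_or_pos l with h | h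
    · simp [h]
    · have : 0 ≤ ρ := le_trans (by positivity) (hρ 0 0 le_rfl h)
      positivity
  calc ‖R l‖ ≤ ‖v‖ + ‖T u‖ := by rw [hTu]; exact norm_sub_le _ _
    _ ≤ ‖v‖ + ‖T‖ * (α * (l * (1 + l * ρ / 2)) * ‖W‖ * (‖G‖ * ‖v‖)) := by
        gcongr
        refine (T.le_opNorm u).trans ?_
        gcongr
        refine hu_le.trans ?_
        gcongr
        exact G.le_opNorm v
    _ = _ := by ring

/-- The momentum is a rescaled sum of the normalized gradients. -/
lemma momentum_eq_neg_smul_sum {E : Type*} [NormedAddCommGroup E] [NormedSpace ℝ E]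
    {R P : ℕ → E} {l : ℕ} (hR : ∀ k ≤ l, R k ≠ 0) (hP1 : P 1 = -R 0)
    (hP : ∀ k, 1 ≤ k → P (k + 1) = -R k + (‖R k‖ ^ 2 / ‖R (k - 1)‖ ^ 2) • P k)
    (k : ℕ) (hk : k ≤ l) :
    P (k + 1) = -(‖R k‖ ^ 2 • ∑ j ∈ Finset.range (k + 1), (‖R j‖ ^ 2)⁻¹ • R j) := by
  induction k with
  | zero =>
    have := norm_pos_iff.2 (hR 0 hk)
    rw [hP1, Finset.sum_range_one, smul_smul, mul_inv_cancel₀ (by positivity), one_smul]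
  | succ k ih =>
    have h0 := norm_pos_iff.2 (hR k (by omega))
    have h1 := norm_pos_iff.2 (hR (k + 1) hk)
    rw [hP (k + 1) (by omega), Nat.add_sub_cancel, ih (by omega), Finset.sum_range_succ _ (k + 1),
      smul_add, smul_smul _ _ (R (k + 1)), mul_inv_cancel₀ (by positivity), one_smul, smul_neg,
      smul_smul, div_mul_cancel₀ _ (by positivity)]
    abel

lemma euclNorm_eq_norm {N : ℕ} (x : Fin N → ℝ) : euclNorm x = ‖WithLp.toLp 2 x‖ := by
  rw [EuclideanSpace.norm_eq, euclNorm]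
  simp

lemma Matrix.pseudoinverse_mul_self {m n : ℕ} (Z : Matrix (Fin m) (Fin n) ℝ)
    (hZ : LinearIndependent ℝ Z.col) : (Zᵀ * Z)⁻¹ * Zᵀ * Z = 1 := by
  have h : (Zᴴ * Z).PosDef :=
    Matrix.PosDef.conjTranspose_mul_self Z (Matrix.mulVec_injective_iff.2 hZ)
  rw [Matrix.conjTranspose_eq_transpose_of_trivial] at h
  rw [Matrix.mul_assoc]
  exact Matrix.nonsing_inv_mul _ ((Matrix.isUnit_iff_isUnit_det _).1 h.isUnit)

/-- **FRGD convergence for a quadratic problem.**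
For `g(x) = ½ xᵀAx + xᵀb` with `A` symmetric positive definite, the iterates of
gradient descent with Fletcher–Reeves momentum and fixed step size `α` satisfy
`‖r^(l)‖ ≤ 2(1+K_l)((√κ(A)-1)/(√κ(A)+1))^l ‖r^(0)‖` with
`0 ≤ K_l ≤ lα(1+lρ/2)‖A‖₂ κ(Z^(l+1))`, provided `z^(0),…,z^(l)` are linearly independent. -/
theorem frgd_quadratic_convergence
    (N : ℕ) (A : Matrix (Fin N) (Fin N) ℝ) (hA : A.PosDef)
    (b : Fin N → ℝ) (α : ℝ) (hα : 0 < α)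
    (x p : ℕ → Fin N → ℝ)
    (r : ℕ → Fin N → ℝ) (hrdef : ∀ k, r k = A.mulVec (x k) + b)
    (hp1 : p 1 = -(r 0)) (hx1 : x 1 = x 0 + α • p 1)
    (hp : ∀ k, 1 ≤ k →
      p (k + 1) = -(r k) + ((euclNorm (r k)) ^ 2 / (euclNorm (r (k - 1))) ^ 2) • p k)
    (hx : ∀ k, 1 ≤ k → x (k + 1) = x k + α • p (k + 1))
    (l : ℕ) (hl : 1 ≤ l)
    (z : ℕ → Fin N → ℝ) (hz : ∀ k, z k = (euclNorm (r k))⁻¹ • r k)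
    (hind : LinearIndependent ℝ (fun k : Fin (l + 1) => z k))
    (ρ : ℝ)
    (hρ : ρ = ⨆ i : Fin l, ⨆ j : Fin l, ⨆ _ : (j : ℕ) ≤ (i : ℕ),
      (euclNorm (r i)) ^ 2 / (euclNorm (r j)) ^ 2)
    (Z : Matrix (Fin N) (Fin (l + 1)) ℝ) (hZ : Z = Matrix.of fun (i : Fin N) (k : Fin (l + 1)) => z k i)
    (κA : ℝ)
    (hκA : κA = (⨆ i, hA.1.eigenvalues i) / (⨅ i, hA.1.eigenvalues i)) :
    ∃ K : ℝ, 0 ≤ K ∧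
      K ≤ (l : ℝ) * α * (1 + (l : ℝ) * ρ / 2) * specNorm A *
            (specNorm Z * specNorm ((Zᵀ * Z)⁻¹ * Zᵀ)) ∧
      euclNorm (r l) ≤
        2 * (1 + K) * ((Real.sqrt κA - 1) / (Real.sqrt κA + 1)) ^ l * euclNorm (r 0) := by
  set R : ℕ → EuclideanSpace ℝ (Fin N) := fun k => WithLp.toLp 2 (r k) with hRdef
  set P : ℕ → EuclideanSpace ℝ (Fin N) := fun k => WithLp.toLp 2 (p k) with hPdef
  have hnorm : ∀ k, euclNorm (r k) = ‖R k‖ := fun k => euclNorm_eq_norm _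
  simp only [hnorm] at hp hz hρ ⊢
  have hR : ∀ k ≤ l, R k ≠ 0 := by
    intro k hk h0
    refine hind.ne_zero ⟨k, by omega⟩ ?_
    simp [hz, h0]
  have hN : Nonempty (Fin N) := by
    by_contra h
    rw [not_nonempty_iff] at h
    exact hR 0 (by omega) (Subsingleton.elim _ _)
  have hP := momentum_eq_neg_smul_sum (P := P) hR (by simp [hPdef, hRdef, hp1])
    (fun k hk => by simp only [hPdef]; rw [hp k hk]; rfl)
  have hxk : ∀ k, x (k + 1) = x k + α • p (k + 1) := by
    intro k
    rcases k with _ | k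
    · exact hx1
    · exact hx _ (by omega)
  set T := (Matrix.toEuclideanLin A).toContinuousLinearMap with hT
  set W := (Matrix.toEuclideanLin Z).toContinuousLinearMap with hW
  set G := (Matrix.toEuclideanLin ((Zᵀ * Z)⁻¹ * Zᵀ)).toContinuousLinearMap with hG
  have hrec : ∀ k < l, R k - R (k + 1) =
      (α * ‖R k‖ ^ 2) • T (∑ j ∈ Finset.range (k + 1), (‖R j‖ ^ 2)⁻¹ • R j) := by
    intro k hk
    have h1 : R k - R (k + 1) = -(α • T (P (k + 1))) := by
      have : r k - r (k + 1) = -(α • A.mulVec (p (k + 1))) := by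
        rw [hrdef, hrdef, hxk, Matrix.mulVec_add, Matrix.mulVec_smul]
        abel
      exact congrArg (WithLp.toLp 2) this
    rw [h1, hP k hk.le, map_neg, map_smul, smul_neg, neg_neg, smul_smul]
  have hcol : LinearIndependent ℝ Z.col := by
    convert hind using 1
    ext k i
    simp [hZ]
  have hGW : ∀ c, G (W c) = c := by
    intro c
    have : ((Zᵀ * Z)⁻¹ * Zᵀ).mulVec (Z.mulVec c.ofLp) = c.ofLp := by
      rw [Matrix.mulVec_mulVec, Matrix.pseudoinverse_mul_self Z hcol, Matrix.one_mulVec]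
    exact congrArg (WithLp.toLp 2) this
  have hWc : ∀ c, W c = ∑ k, c k • (‖R k‖⁻¹ • R k) := by
    intro c
    ext i
    simp [hW, hZ, hz, hRdef, Matrix.mulVec, dotProduct, mul_comm]
  have hρle : ∀ i j, j ≤ i → i < l → ‖R i‖ ^ 2 / ‖R j‖ ^ 2 ≤ ρ := by
    intro i j hji hil
    have h1 := le_ciSup (Finite.bddAbove_range fun i : Fin l => ⨆ j : Fin l, ⨆ _ : (j : ℕ) ≤ (i : ℕ),
      ‖R i‖ ^ 2 / ‖R j‖ ^ 2) ⟨i, hil⟩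
    have h2 := le_ciSup (Finite.bddAbove_range fun j : Fin l => ⨆ _ : (j : ℕ) ≤ i,
      ‖R i‖ ^ 2 / ‖R j‖ ^ 2) ⟨j, by omega⟩
    rw [hρ]
    refine le_trans ?_ (h2.trans h1)
    simp [hji]
  have hρ0 : 0 ≤ ρ := le_trans (by positivity) (hρle 0 0 le_rfl hl)
  have hbdd := Finite.bddBelow_range hA.1.eigenvalues
  have hbdd' := Finite.bddAbove_range hA.1.eigenvalues
  have ha : 0 < ⨅ i, hA.1.eigenvalues i := by
    obtain ⟨i, hi⟩ := exists_eq_ciInf_of_finite (f := hA.1.eigenvalues)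
    rw [← hi]
    exact hA.eigenvalues_pos i
  have hab : ⨅ i, hA.1.eigenvalues i ≤ ⨆ i, hA.1.eigenvalues i :=
    (ciInf_le hbdd hN.some).trans (le_ciSup hbdd' hN.some)
  obtain ⟨q, hq, hq0, hqle⟩ := exists_polynomial_abs_eval_le ha hab hl
  rw [← hκA] at hqle
  have hκ1 : 1 ≤ √κA := by
    rw [Real.one_le_sqrt, hκA, one_le_div ha]
    exact hab
  have hM : 0 ≤ (√κA - 1) / (√κA + 1) := div_nonneg (by linarith) (by linarith)
  have hqT := hA.1.eigenvectorBasis.norm_aeval_apply_le (T : Module.End ℝ _) hA.1.eigenvalues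
    (fun i => congrArg (WithLp.toLp 2) (hA.1.mulVec_eigenvectorBasis i)) q (by positivity)
    (fun i => hqle _ (ciInf_le hbdd i) (le_ciSup hbdd' i)) (R 0)
  have hmain := norm_residual_le T W G hGW R hR hWc hα hρle hrec q hq hq0
  refine ⟨_, ?_, le_rfl, ?_⟩
  · unfold specNorm
    positivity
  · change ‖R l‖ ≤ 2 * (1 + l * α * (1 + l * ρ / 2) * ‖T‖ * (‖W‖ * ‖G‖)) *
      ((√κA - 1) / (√κA + 1)) ^ l * ‖R 0‖
    calc _ ≤ _ := hmain
      _ ≤ (1 + l * α * (1 + l * ρ / 2) * ‖T‖ * (‖W‖ * ‖G‖)) *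
          (2 * ((√κA - 1) / (√κA + 1)) ^ l * ‖R 0‖) := by gcongr
      _ = _ := by ring
end

section
/- Under the residual/direction recursion, A Z^(l) = Z^(l) T^(l) − r^(l) e_lᵀ / (α ‖r^(l−1)‖₂), where T^(l) = (1/α) D^(l) L^(l) U^(l) (D^(l))^{−1}. -/
open Matrix

theorem euclNorm_ne_zero {N : ℕ} {x : Fin N → ℝ} (hx : x ≠ 0) : euclNorm x ≠ 0 := by
  obtain ⟨i, hi⟩ := Function.ne_iff.mp hx
  refine (Real.sqrt_pos.mpr ?_).ne'
  exact Finset.sum_pos' (fun j _ => sq_nonneg (x j)) ⟨i, Finset.mem_univ i, sq_pos_of_ne_zero hi⟩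

/-- A sum against a column of an upper bidiagonal matrix with unit diagonal. -/
theorem sum_mul_upperBidiagonal {l : ℕ} (f : ℕ → ℝ) (b : ℝ) (j : Fin l) :
    ∑ k : Fin l, f k * (if (k : ℕ) = (j : ℕ) then 1 else if (j : ℕ) = (k : ℕ) + 1 then b else 0) =
      f j + if (j : ℕ) = 0 then 0 else f (j - 1) * b := by
  obtain ⟨j, hj⟩ := j
  rw [Fin.sum_univ_eq_sum_range
    (fun k => f k * (if k = j then 1 else if j = k + 1 then b else 0)) l]
  have h (k : ℕ) : f k * (if k = j then 1 else if j = k + 1 then b else 0) =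
      (if k = j then f k else 0) + if k = j - 1 then (if j = 0 then 0 else f k * b) else 0 := by
    split_ifs <;> first | omega | simp
  simp only [h, Finset.sum_add_distrib, Finset.sum_ite_eq', Finset.mem_range]
  rw [if_pos hj, if_pos (by omega)]

/-- A sum against a column of a lower bidiagonal matrix with unit diagonal. -/
theorem sum_mul_lowerBidiagonal {l : ℕ} (f : ℕ → ℝ) (b : ℝ) (j : Fin l) :
    ∑ k : Fin l, f k * (if (k : ℕ) = (j : ℕ) then 1 else if (k : ℕ) = (j : ℕ) + 1 then b else 0) =
      f j + if (j : ℕ) + 1 < l then f (j + 1) * b else 0 := by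
  obtain ⟨j, hj⟩ := j
  rw [Fin.sum_univ_eq_sum_range
    (fun k => f k * (if k = j then 1 else if k = j + 1 then b else 0)) l]
  have h (k : ℕ) : f k * (if k = j then 1 else if k = j + 1 then b else 0) =
      (if k = j then f k else 0) + if k = j + 1 then f k * b else 0 := by
    split_ifs <;> first | omega | simp
  simp only [h, Finset.sum_add_distrib, Finset.sum_ite_eq', Finset.mem_range]
  rw [if_pos hj]

/-- **Matrix identity for the FRGD residual/direction recursion:**
`A Z^(l) = Z^(l) T^(l) − r^(l) e_lᵀ / (α ‖r^(l−1)‖₂)`, where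
`T^(l) = (1/α) D^(l) L^(l) U^(l) (D^(l))⁻¹`. -/
theorem frgd_arnoldi_like_identity
    (N l : ℕ) (hl : 1 ≤ l)
    (A : Matrix (Fin N) (Fin N) ℝ) (α : ℝ) (hα : 0 < α)
    (r p : ℕ → Fin N → ℝ) (β : ℕ → ℝ)
    (hrne : ∀ j ≤ l, r j ≠ 0)
    (hp0 : p 0 = r 0)
    (hp : ∀ j, 1 ≤ j → j < l → p j = r j + β j • p (j - 1))
    (hr : ∀ j < l, r (j + 1) = r j - α • A.mulVec (p j))
    (R : Matrix (Fin N) (Fin l) ℝ)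
    (hR : R = Matrix.of fun (i : Fin N) (j : Fin l) => r j i)
    (D : Matrix (Fin l) (Fin l) ℝ)
    (hD : D = Matrix.diagonal fun j : Fin l => euclNorm (r j))
    (Z : Matrix (Fin N) (Fin l) ℝ) (hZ : Z = R * D⁻¹)
    (P : Matrix (Fin N) (Fin l) ℝ)
    (hP : P = Matrix.of fun (i : Fin N) (j : Fin l) => p j i)
    (L : Matrix (Fin l) (Fin l) ℝ)
    (hL : L = Matrix.of fun (i j : Fin l) =>
      if (i : ℕ) = (j : ℕ) then 1 else if (i : ℕ) = (j : ℕ) + 1 then -1 else 0)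
    (U : Matrix (Fin l) (Fin l) ℝ)
    (hU : U = Matrix.of fun (i j : Fin l) =>
      if (i : ℕ) = (j : ℕ) then 1 else if (j : ℕ) = (i : ℕ) + 1 then -β j else 0)
    (e : Fin l → ℝ) (he : e = fun i : Fin l => if (i : ℕ) = l - 1 then 1 else 0)
    (T : Matrix (Fin l) (Fin l) ℝ) (hT : T = α⁻¹ • (D * L * U * D⁻¹)) :
    A * Z = Z * T - (α * euclNorm (r (l - 1)))⁻¹ • Matrix.vecMulVec (r l) e := by
  have hPU : P * U = R := by
    ext i j
    simp only [hP, hU, hR, mul_apply, of_apply]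
    rw [sum_mul_upperBidiagonal (fun k => p k i)]
    split_ifs with h
    · simp [h, hp0]
    · simp only [hp j (by omega) j.isLt, Pi.add_apply, Pi.smul_apply, smul_eq_mul]
      ring
  have hAP : α • (A * P) = R * L - vecMulVec (r l) e := by
    ext i j
    have hAp : (A * P) i j = (A *ᵥ p j) i := by
      simp [hP, mul_apply, mulVec, dotProduct]
    have hri := congrFun (hr j j.isLt) i
    simp only [Pi.sub_apply, Pi.smul_apply, smul_eq_mul] at hri
    simp only [Matrix.smul_apply, Matrix.sub_apply, smul_eq_mul, hAp, vecMulVec_apply, he]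
    simp only [hR, hL, mul_apply, of_apply]
    rw [sum_mul_lowerBidiagonal (fun k => r k i)]
    by_cases h : (j : ℕ) + 1 < l
    · rw [if_pos h, if_neg (by omega)]
      linarith
    · have hj : (j : ℕ) + 1 = l := by omega
      rw [if_neg h, if_pos (by omega)]
      rw [hj] at hri
      linarith
  have heU : e ᵥ* U = e := by
    ext j
    simp only [vecMul, dotProduct, he, hU, of_apply]
    rw [sum_mul_upperBidiagonal (fun k => if k = l - 1 then 1 else 0)]
    have := j.isLt
    split_ifs <;> first | omega | simp
  have hnorm (j : Fin l) : euclNorm (r j) ≠ 0 := euclNorm_ne_zero (hrne j j.isLt.le)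
  have hDinv : D⁻¹ = diagonal fun j : Fin l => (euclNorm (r j))⁻¹ := by
    refine inv_eq_right_inv ?_
    rw [hD, diagonal_mul_diagonal]
    simp [hnorm]
  have hDD : D⁻¹ * D = 1 := by
    rw [hDinv, hD, diagonal_mul_diagonal]
    simp [hnorm]
  have heD : e ᵥ* D⁻¹ = (euclNorm (r (l - 1)))⁻¹ • e := by
    ext j
    rw [hDinv, vecMul_diagonal]
    simp only [he, Pi.smul_apply, smul_eq_mul]
    split_ifs with h
    · rw [h, mul_comm]
    · simp
  have hAR : α • (A * R) = R * L * U - vecMulVec (r l) e := by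
    rw [← hPU, ← Matrix.mul_assoc, ← Matrix.smul_mul, hAP, hPU, Matrix.sub_mul,
      vecMulVec_mul, heU]
  have hZT : Z * T = α⁻¹ • (R * L * U * D⁻¹) := by
    rw [hZ, hT, Matrix.mul_smul]
    simp only [Matrix.mul_assoc]
    rw [← Matrix.mul_assoc D⁻¹ D, hDD, Matrix.one_mul]
  have hAR' : A * R = α⁻¹ • (R * L * U - vecMulVec (r l) e) := by
    rw [← hAR, inv_smul_smul₀ hα.ne']
  rw [hZT, hZ, ← Matrix.mul_assoc, hAR', Matrix.smul_mul, Matrix.sub_mul, vecMulVec_mul, heD,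
    vecMulVec_smul, smul_sub, smul_smul, mul_inv]
end

section
/- Assume additionally that β^(j) ≠ 0 for 1 ≤ j ≤ l−1, so that T^(l) = (1/α) D^(l) L^(l) U^(l) (D^(l))^{−1} is invertible. Then e_lᵀ (T^(l))^{−1} e_1 = α ‖r^(l−1)‖₂ / ‖r^(0)‖₂, where e_1 = (1,0,…,0)ᵀ and e_l = (0,…,0,1)ᵀ in ℝ^l. -/
open Matrix

theorem det_lowerBidiagonal (l : ℕ) :
    (Matrix.of fun (i j : Fin l) =>
      if (i : ℕ) = (j : ℕ) then (1 : ℝ) else if (i : ℕ) = (j : ℕ) + 1 then -1 else 0).det = 1 := by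
  rw [det_of_isLowerTriangular]
  · simp
  · intro i j hij
    have : (i : ℕ) < j := hij
    simp only [of_apply]
    rw [if_neg (by omega), if_neg (by omega)]

theorem det_upperBidiagonal (l : ℕ) (β : ℕ → ℝ) :
    (Matrix.of fun (i j : Fin l) =>
      if (i : ℕ) = (j : ℕ) then (1 : ℝ)
      else if (j : ℕ) = (i : ℕ) + 1 then -β j else 0).det = 1 := by
  rw [det_of_isUpperTriangular]
  · simp
  · intro i j hij
    have : (j : ℕ) < i := hij
    simp only [of_apply]
    rw [if_neg (by omega), if_neg (by omega)]

theorem one_vecMul_lowerBidiagonal (l : ℕ) :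
    (1 : Fin l → ℝ) ᵥ* (Matrix.of fun (i j : Fin l) =>
      if (i : ℕ) = (j : ℕ) then (1 : ℝ) else if (i : ℕ) = (j : ℕ) + 1 then -1 else 0) =
    fun i : Fin l => if (i : ℕ) = l - 1 then 1 else 0 := by
  ext j
  have hsplit (i : ℕ) : (if i = (j : ℕ) then (1 : ℝ) else if i = (j : ℕ) + 1 then -1 else 0) =
      (if i = (j : ℕ) then 1 else 0) - (if i = (j : ℕ) + 1 then 1 else 0) := by
    split_ifs <;> first | omega | norm_num
  simp only [vecMul, dotProduct, Pi.one_apply, one_mul, of_apply, hsplit]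
  rw [Fin.sum_univ_eq_sum_range (fun i =>
    (if i = (j : ℕ) then (1 : ℝ) else 0) - (if i = (j : ℕ) + 1 then 1 else 0))]
  have := j.isLt
  simp only [Finset.sum_sub_distrib, Finset.sum_ite_eq', Finset.mem_range]
  split_ifs <;> first | omega | norm_num

theorem single_last_vecMul_upperBidiagonal (n : ℕ) (β : ℕ → ℝ) :
    Pi.single (Fin.last n) (1 : ℝ) ᵥ* (Matrix.of fun (i j : Fin (n + 1)) =>
      if (i : ℕ) = (j : ℕ) then (1 : ℝ) else if (j : ℕ) = (i : ℕ) + 1 then -β j else 0) =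
    Pi.single (Fin.last n) 1 := by
  ext j
  have := j.isLt
  simp only [single_one_vecMul, row_apply, of_apply, Fin.val_last, Pi.single_apply, Fin.ext_iff]
  split_ifs <;> first | omega | rfl

/-- Under the FRGD residual/direction recursion, assuming in addition that the momentum
coefficients `β^(1), …, β^(l−1)` are nonzero, `T^(l) = (1/α) D^(l) L^(l) U^(l) (D^(l))⁻¹`
is invertible and `e_lᵀ (T^(l))⁻¹ e_1 = α ‖r^(l−1)‖₂ / ‖r^(0)‖₂`. -/
theorem frgd_T_inverse_corner_entry
    (N l : ℕ) (hl : 1 ≤ l)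
    (A : Matrix (Fin N) (Fin N) ℝ) (α : ℝ) (hα : 0 < α)
    (r p : ℕ → Fin N → ℝ) (β : ℕ → ℝ)
    (hrne : ∀ j ≤ l, r j ≠ 0)
    (hp0 : p 0 = r 0)
    (hp : ∀ j, 1 ≤ j → j < l → p j = r j + β j • p (j - 1))
    (hr : ∀ j < l, r (j + 1) = r j - α • A.mulVec (p j))
    (hβne : ∀ j, 1 ≤ j → j < l → β j ≠ 0)
    (D : Matrix (Fin l) (Fin l) ℝ)
    (hD : D = Matrix.diagonal fun j : Fin l => euclNorm (r j))
    (L : Matrix (Fin l) (Fin l) ℝ)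
    (hL : L = Matrix.of fun (i j : Fin l) =>
      if (i : ℕ) = (j : ℕ) then 1 else if (i : ℕ) = (j : ℕ) + 1 then -1 else 0)
    (U : Matrix (Fin l) (Fin l) ℝ)
    (hU : U = Matrix.of fun (i j : Fin l) =>
      if (i : ℕ) = (j : ℕ) then 1 else if (j : ℕ) = (i : ℕ) + 1 then -β j else 0)
    (T : Matrix (Fin l) (Fin l) ℝ) (hT : T = α⁻¹ • (D * L * U * D⁻¹))
    (e1 el : Fin l → ℝ)
    (he1 : e1 = fun i : Fin l => if (i : ℕ) = 0 then 1 else 0)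
    (hel : el = fun i : Fin l => if (i : ℕ) = l - 1 then 1 else 0) :
    IsUnit T ∧ el ⬝ᵥ (T⁻¹).mulVec e1 = α * euclNorm (r (l - 1)) / euclNorm (r 0) := by
  obtain ⟨n, rfl⟩ : ∃ n, l = n + 1 := ⟨l - 1, by omega⟩
  have hd (j : Fin (n + 1)) : euclNorm (r j) ≠ 0 := euclNorm_ne_zero (hrne j j.isLt.le)
  have hn : euclNorm (r n) ≠ 0 := hd (Fin.last n)
  have hdetL : L.det = 1 := hL ▸ det_lowerBidiagonal (n + 1)
  have hdetU : U.det = 1 := hU ▸ det_upperBidiagonal (n + 1) β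
  have hdetD : IsUnit D.det := by
    rw [hD, det_diagonal]
    exact (Finset.prod_ne_zero_iff.mpr fun j _ => hd j).isUnit
  have hdetT : IsUnit T.det := by
    rw [hT, det_smul, det_mul, det_mul, det_mul, hdetL, hdetU, mul_one, mul_one, ← det_mul,
      mul_nonsing_inv _ hdetD, det_one, mul_one]
    exact (pow_ne_zero _ (inv_ne_zero hα.ne')).isUnit
  refine ⟨(isUnit_iff_isUnit_det T).mpr hdetT, ?_⟩
  have hel' : el = Pi.single (Fin.last n) 1 := by
    ext i
    simp only [hel, Pi.single_apply, Fin.ext_iff, Fin.val_last, Nat.add_sub_cancel]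
  have he1' : e1 = Pi.single 0 1 := by
    ext i
    simp only [he1, Pi.single_apply, Fin.ext_iff, Fin.val_zero]
  have hwD : (fun j : Fin (n + 1) => (euclNorm (r j))⁻¹) ᵥ* D = 1 := by
    ext j
    simp [hD, vecMul_diagonal, hd j]
  have hoL : (1 : Fin (n + 1) → ℝ) ᵥ* L = el := by
    rw [hL, hel, one_vecMul_lowerBidiagonal]
  have heU : el ᵥ* U = el := by
    rw [hU, hel', single_last_vecMul_upperBidiagonal]
  have heD : el ᵥ* D = euclNorm (r n) • el := by
    ext j
    rw [hD, vecMul_diagonal, hel']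
    by_cases hj : j = Fin.last n
    · simp [hj]
    · simp [hj]
  have hrow : (fun j : Fin (n + 1) => (euclNorm (r j))⁻¹) ᵥ* T =
      (α⁻¹ * (euclNorm (r n))⁻¹) • el := by
    have heDinv : el ᵥ* D⁻¹ = (euclNorm (r n))⁻¹ • el := by
      have h := congrArg (fun v => (euclNorm (r n))⁻¹ • (v ᵥ* D⁻¹)) heD
      simp only [vecMul_vecMul, mul_nonsing_inv _ hdetD, vecMul_one, smul_vecMul] at h
      rw [h, smul_smul, inv_mul_cancel₀ hn, one_smul]
    rw [hT, vecMul_smul, ← vecMul_vecMul, ← vecMul_vecMul, ← vecMul_vecMul, hwD, hoL, heU, heDinv,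
      smul_smul]
  have hinv : el ᵥ* T⁻¹ =
      (α * euclNorm (r n)) • fun j : Fin (n + 1) => (euclNorm (r j))⁻¹ := by
    have h := congrArg (fun v => (α * euclNorm (r n)) • (v ᵥ* T⁻¹)) hrow
    simp only [vecMul_vecMul, mul_nonsing_inv _ hdetT, vecMul_one, smul_vecMul] at h
    rw [h, smul_smul, ← mul_inv, mul_inv_cancel₀ (mul_ne_zero hα.ne' hn), one_smul]
  rw [dotProduct_mulVec, hinv, he1']
  simp [div_eq_mul_inv]
end

section
/- If the momentum coefficients are the Fletcher–Reeves coefficients β^(j) = ‖r^(j)‖₂²/‖r^(j−1)‖₂², then the similarity-transformed bidiagonal factors satisfy D^(l) U^(l) (D^(l))^{−1} = (D^(l) L^(l) (D^(l))^{−1})ᵀ; consequently, writing L̃^(l) = D^(l) L^(l) (D^(l))^{−1}, the matrix T^(l) = (1/α) D^(l) L^(l) U^(l) (D^(l))^{−1} equals (1/α) L̃^(l) (L̃^(l))ᵀ, where L̃^(l) is the l×l lower bidiagonal matrix with ones on the diagonal and −√(β^(1)),…,−√(β^(l−1)) on the subdiagonal. -/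
open Matrix

theorem euclNorm_pos {N : ℕ} {x : Fin N → ℝ} (hx : x ≠ 0) : 0 < euclNorm x := by
  obtain ⟨i, hi⟩ := Function.ne_iff.mp hx
  exact Real.sqrt_pos.mpr <|
    Finset.sum_pos' (fun _ _ => sq_nonneg _) ⟨i, Finset.mem_univ i, sq_pos_of_ne_zero hi⟩

theorem diagonal_conj_apply {n : Type*} [Fintype n] [DecidableEq n] {d : n → ℝ}
    (hd : ∀ i, d i ≠ 0) (M : Matrix n n ℝ) (i j : n) :
    (diagonal d * M * (diagonal d)⁻¹) i j = d i * M i j / d j := by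
  have hinv : (diagonal d)⁻¹ = diagonal fun i => (d i)⁻¹ :=
    Matrix.inv_eq_right_inv (by simp [diagonal_mul_diagonal, hd])
  rw [hinv, mul_diagonal, diagonal_mul, div_eq_mul_inv]

/-- With the Fletcher–Reeves coefficients `β^(j) = ‖r^(j)‖²/‖r^(j−1)‖²`, one has
`D U D⁻¹ = (D L D⁻¹)ᵀ`; consequently, writing `L̃ = D L D⁻¹`,
`T = (1/α) D L U D⁻¹ = (1/α) L̃ L̃ᵀ`, where `L̃` is lower bidiagonal with ones on the
diagonal and `−√β^(1), …, −√β^(l−1)` on the subdiagonal. -/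
theorem fr_bidiagonal_symmetrization
    (N l : ℕ) (hl : 1 ≤ l) (α : ℝ) (hα : 0 < α)
    (r : ℕ → Fin N → ℝ) (hrne : ∀ j < l, r j ≠ 0)
    (β : ℕ → ℝ)
    (hβ : ∀ j, 1 ≤ j → β j = (euclNorm (r j)) ^ 2 / (euclNorm (r (j - 1))) ^ 2)
    (D : Matrix (Fin l) (Fin l) ℝ)
    (hD : D = Matrix.diagonal fun j : Fin l => euclNorm (r j))
    (L : Matrix (Fin l) (Fin l) ℝ)
    (hL : L = Matrix.of fun (i j : Fin l) =>
      if (i : ℕ) = (j : ℕ) then 1 else if (i : ℕ) = (j : ℕ) + 1 then -1 else 0)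
    (U : Matrix (Fin l) (Fin l) ℝ)
    (hU : U = Matrix.of fun (i j : Fin l) =>
      if (i : ℕ) = (j : ℕ) then 1 else if (j : ℕ) = (i : ℕ) + 1 then -β j else 0)
    (Lt : Matrix (Fin l) (Fin l) ℝ) (hLt : Lt = D * L * D⁻¹) :
    D * U * D⁻¹ = (D * L * D⁻¹)ᵀ ∧
    α⁻¹ • (D * L * U * D⁻¹) = α⁻¹ • (Lt * Ltᵀ) ∧
    Lt = Matrix.of fun (i j : Fin l) =>
      if (i : ℕ) = (j : ℕ) then 1
      else if (i : ℕ) = (j : ℕ) + 1 then -Real.sqrt (β i) else 0 := by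
  have hpos : ∀ j : Fin l, 0 < euclNorm (r j) := fun j => euclNorm_pos (hrne j j.isLt)
  have hne : ∀ j : Fin l, euclNorm (r j) ≠ 0 := fun j => (hpos j).ne'
  have hsymm : D * U * D⁻¹ = (D * L * D⁻¹)ᵀ := by
    ext i j
    rw [transpose_apply, hD, diagonal_conj_apply hne, diagonal_conj_apply hne, hU, hL]
    simp only [of_apply, eq_comm (a := (j : ℕ)) (b := (i : ℕ))]
    have hi := hne i
    have hj := hne j
    split_ifs with h₁ h₂
    · rw [h₁]
    · rw [hβ j (by omega), show (j : ℕ) - 1 = i by omega]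
      field_simp
    · simp
  refine ⟨hsymm, ?_, ?_⟩
  · have hdet : IsUnit D.det := by
      rw [hD, det_diagonal, isUnit_iff_ne_zero]
      exact Finset.prod_ne_zero_iff.mpr fun j _ => hne j
    rw [hLt, ← hsymm]
    simp only [Matrix.mul_assoc, nonsing_inv_mul_cancel_left _ _ hdet]
  · ext i j
    rw [hLt, hD, diagonal_conj_apply hne, hL]
    simp only [of_apply]
    split_ifs with h₁ h₂
    · rw [h₁, mul_one, div_self (hne j)]
    · rw [hβ i (by omega), show (i : ℕ) - 1 = j by omega, ← div_pow,
        Real.sqrt_sq (div_pos (hpos i) (hpos j)).le]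
      ring
    · simp
end

section
/- Let A be a real M×N matrix, λ > 0, and x* ∈ ℝ^N with x* ≠ 0. Suppose p ∈ ℝ^N satisfies |p_i| ≤ 1 for all i and p_i = sign(x*_i) whenever x*_i ≠ 0, and suppose y ∈ ℝ^M satisfies Aᵀy = p − x*/‖x*‖₂. Define b = λy + A x*. Then x* is a directional-stationary point of F(x) = λ(‖x‖₁ − ‖x‖₂) + (1/2)‖Ax − b‖₂²: for every direction d ∈ ℝ^N, the one-sided directional derivative F′(x*; d) = lim_{t→0⁺} (F(x* + t d) − F(x*))/t exists and is nonnegative. -/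
open Matrix

theorem euclNorm_sq {N : ℕ} (x : Fin N → ℝ) : euclNorm x ^ 2 = ∑ i, x i ^ 2 :=
  Real.sq_sqrt (Finset.sum_nonneg fun _ _ => sq_nonneg _)

theorem sum_sq_ne_zero {N : ℕ} {x : Fin N → ℝ} (hx : x ≠ 0) : ∑ i, x i ^ 2 ≠ 0 := by
  intro h
  rw [Finset.sum_eq_zero_iff_of_nonneg fun _ _ => sq_nonneg _] at h
  exact hx (funext fun i => pow_eq_zero_iff two_ne_zero |>.1 (h i (Finset.mem_univ i)))

theorem hasDerivAt_sum_sq_add_smul {N : ℕ} (x d : Fin N → ℝ) :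
    HasDerivAt (fun t : ℝ => ∑ i, (x i + t * d i) ^ 2) (2 * (x ⬝ᵥ d)) 0 := by
  rw [dotProduct, Finset.mul_sum]
  refine HasDerivAt.fun_sum fun i _ => ?_
  have h := (((hasDerivAt_id (0 : ℝ)).mul_const (d i)).const_add (x i)).pow 2
  refine h.congr_deriv ?_
  simp
  ring

theorem hasDerivAt_euclNorm_add_smul {N : ℕ} {x : Fin N → ℝ} (hx : x ≠ 0) (d : Fin N → ℝ) :
    HasDerivAt (fun t : ℝ => euclNorm (x + t • d)) ((euclNorm x)⁻¹ * (x ⬝ᵥ d)) 0 := by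
  have h := (hasDerivAt_sum_sq_add_smul x d).sqrt (by simpa using sum_sq_ne_zero hx)
  refine h.congr_deriv ?_
  simp only [zero_mul, add_zero, euclNorm]
  rw [mul_div_mul_left _ _ two_ne_zero, div_eq_inv_mul]

/-- The right derivative at `0` of `t ↦ |a + t * c|`. -/
theorem hasDerivWithinAt_abs_add_mul (a c : ℝ) :
    HasDerivWithinAt (fun t : ℝ => |a + t * c|)
      (if a = 0 then |c| else Real.sign a * c) (Set.Ioi 0) 0 := by
  have hl : HasDerivAt (fun t : ℝ => a + t * c) c 0 := by
    simpa using ((hasDerivAt_id (0 : ℝ)).mul_const c).const_add a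
  split_ifs with ha
  · subst ha
    have h : HasDerivWithinAt (fun t : ℝ => t * |c|) |c| (Set.Ioi 0) 0 := by
      simpa using ((hasDerivAt_id (0 : ℝ)).mul_const |c|).hasDerivWithinAt
    refine h.congr (fun t ht => ?_) (by simp)
    rw [zero_add, abs_mul, abs_of_pos ht]
  · rcases lt_or_gt_of_ne ha with ha | ha
    · rw [Real.sign_of_neg ha]
      refine ((hasDerivAt_abs_neg (by simpa using ha)).comp (0 : ℝ) hl).hasDerivWithinAt
        |>.congr_deriv ?_
      simp
    · rw [Real.sign_of_pos ha]
      refine ((hasDerivAt_abs_pos (by simpa using ha)).comp (0 : ℝ) hl).hasDerivWithinAt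
        |>.congr_deriv ?_
      simp

theorem mul_le_ite_abs_sign {a c q : ℝ} (hq : |q| ≤ 1) (hs : a ≠ 0 → q = Real.sign a) :
    q * c ≤ if a = 0 then |c| else Real.sign a * c := by
  split_ifs with ha
  · calc q * c ≤ |q| * |c| := by rw [← abs_mul]; exact le_abs_self _
      _ ≤ |c| := mul_le_of_le_one_left (abs_nonneg c) hq
  · rw [hs ha]

/-- **Constructed stationary points for the ℓ₁−ℓ₂ problem.** If `x* ≠ 0`,
`p ∈ Sign(x*)`, `Aᵀy = p − x*/‖x*‖₂`, and `b = λy + Ax*`, then `x*` is a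
directional-stationary point of `F(x) = λ(‖x‖₁ − ‖x‖₂) + ½‖Ax − b‖₂²`: for every
direction `d` the one-sided directional derivative `F′(x*; d)` exists and is `≥ 0`. -/
theorem l1_minus_l2_constructed_stationary
    (M N : ℕ) (A : Matrix (Fin M) (Fin N) ℝ)
    (lam : ℝ) (hlam : 0 < lam) (xs : Fin N → ℝ) (hxs : xs ≠ 0)
    (p : Fin N → ℝ)
    (hp1 : ∀ i, |p i| ≤ 1)
    (hp2 : ∀ i, xs i ≠ 0 → p i = Real.sign (xs i))
    (y : Fin M → ℝ) (hy : Aᵀ.mulVec y = p - (euclNorm xs)⁻¹ • xs)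
    (b : Fin M → ℝ) (hb : b = lam • y + A.mulVec xs)
    (F : (Fin N → ℝ) → ℝ)
    (hF : F = fun x =>
      lam * ((∑ i, |x i|) - euclNorm x) + (1 / 2) * (euclNorm (A.mulVec x - b)) ^ 2) :
    ∀ d : Fin N → ℝ, ∃ Fd : ℝ, 0 ≤ Fd ∧
      Filter.Tendsto (fun t : ℝ => (F (xs + t • d) - F xs) / t)
        (nhdsWithin 0 (Set.Ioi 0)) (nhds Fd) := by
  intro d
  set s : Fin N → ℝ := fun i => if xs i = 0 then |d i| else Real.sign (xs i) * d i
  have hdot : y ⬝ᵥ A *ᵥ d = p ⬝ᵥ d - (euclNorm xs)⁻¹ * (xs ⬝ᵥ d) := by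
    rw [dotProduct_mulVec, ← mulVec_transpose, hy, sub_dotProduct, smul_dotProduct, smul_eq_mul]
  have hl1 : HasDerivWithinAt (fun t : ℝ => ∑ i, |(xs + t • d) i|) (∑ i, s i) (Set.Ioi 0) 0 :=
    HasDerivWithinAt.fun_sum fun i _ => hasDerivWithinAt_abs_add_mul (xs i) (d i)
  have hl2 := (hasDerivAt_euclNorm_add_smul hxs d).hasDerivWithinAt (s := Set.Ioi 0)
  have hquad : HasDerivAt (fun t : ℝ => euclNorm (A *ᵥ (xs + t • d) - b) ^ 2)
      (2 * ((-(lam • y)) ⬝ᵥ A *ᵥ d)) 0 := by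
    convert hasDerivAt_sum_sq_add_smul (-(lam • y)) (A *ᵥ d) using 2 with t
    rw [euclNorm_sq, hb, mulVec_add, mulVec_smul]
    refine Finset.sum_congr rfl fun i _ => ?_
    simp only [Pi.sub_apply, Pi.add_apply, Pi.neg_apply, Pi.smul_apply, smul_eq_mul]
    ring
  have hder : HasDerivWithinAt (fun t : ℝ => F (xs + t • d)) (lam * ∑ i, (s i - p i * d i))
      (Set.Ioi 0) 0 := by
    rw [hF]
    refine (((hl1.sub hl2).const_mul lam).add
      (hquad.hasDerivWithinAt.const_mul (1 / 2))).congr_deriv ?_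
    rw [neg_dotProduct, smul_dotProduct, smul_eq_mul, hdot, Finset.sum_sub_distrib]
    simp only [dotProduct]
    ring
  refine ⟨lam * ∑ i, (s i - p i * d i), mul_nonneg hlam.le (Finset.sum_nonneg fun i _ =>
    sub_nonneg.2 (mul_le_ite_abs_sign (hp1 i) (hp2 i))), ?_⟩
  have h := (hasDerivWithinAt_iff_tendsto_slope' Set.self_notMem_Ioi).1 hder
  refine h.congr fun t => ?_
  simp [slope_def_field]
end
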